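/- If V is a G-module such that β_k(G,V) = β_k(G) (i.e., V attains the supremum defining β_k(G)), then β_k(G,V) = β_k(F[V], F[V]^G) + 1. -/

import Mathlib

open scoped ENNReal


open MvPolynomial

/-- The (right) action of a group element `g` on the coordinate ring `F[V]` of `V = ι → F`,
determined by `(f^g)(v) = f (g • v)` where `g` acts on `V` through the representation `ρ`. -/
noncomputable def polyAct {F : Type*} [Field F] {G : Type*} [Group G] {ι : Type*}
    [Fintype ι] [DecidableEq ι] (ρ : Representation F G (ι → F)) (g : G) :
    MvPolynomial ι F →ₐ[F] MvPolynomial ι F :=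
  MvPolynomial.aeval (fun i => ∑ j, (ρ g (Pi.single j 1) i) • MvPolynomial.X j)

/-- The ring of polynomial invariants `F[V]^G`. -/
noncomputable def invRing {F : Type*} [Field F] {G : Type*} [Group G] {ι : Type*}
    [Fintype ι] [DecidableEq ι] (ρ : Representation F G (ι → F)) :
    Subalgebra F (MvPolynomial ι F) :=
  ⨅ g : G, AlgHom.equalizer (polyAct ρ g) (AlgHom.id F (MvPolynomial ι F))

/-- The degree `d` homogeneous component of a graded subalgebra `S` of the polynomial ring,
as a subspace of the polynomial ring. -/
noncomputable def subComp {F : Type*} [Field F] {ι : Type*} (S : Subalgebra F (MvPolynomial ι F)) (d : ℕ) :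
    Submodule F (MvPolynomial ι F) :=
  Subalgebra.toSubmodule S ⊓ homogeneousSubmodule ι F d

/-- `S_+`, the span of the homogeneous elements of positive degree of `S`. -/
noncomputable def subPos {F : Type*} [Field F] {ι : Type*} (S : Subalgebra F (MvPolynomial ι F)) :
    Submodule F (MvPolynomial ι F) :=
  ⨆ d ∈ Set.Ioi (0 : ℕ), subComp S d

/-- `β_k(S)`, the top degree of `S_+ / S_+^{k+1}`, i.e. the supremum (in `ℕ∞`) of the degrees `d`
such that the degree `d` component of `S_+` is not contained in `S_+^{k+1}`. -/
noncomputable def betaAlg {F : Type*} [Field F] {ι : Type*}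
    (S : Subalgebra F (MvPolynomial ι F)) (k : ℕ) : ℕ∞ :=
  sSup ((fun d : ℕ => (d : ℕ∞)) '' {d | 0 < d ∧ ¬ subComp S d ≤ subPos S ^ (k + 1)})

/-- `β_k(F[V], S)`, the top degree of `F[V]/S_+^k F[V]`, i.e. the supremum (in `ℕ∞`) of the
degrees `d` such that the degree `d` component of the polynomial ring is not contained in
`S_+^k ⬝ F[V]`. -/
noncomputable def betaMod {F : Type*} [Field F] {ι : Type*}
    (S : Subalgebra F (MvPolynomial ι F)) (k : ℕ) : ℕ∞ :=
  sSup ((fun d : ℕ => (d : ℕ∞)) ''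
    {d | ¬ homogeneousSubmodule ι F d ≤ subPos S ^ k * (⊤ : Submodule F (MvPolynomial ι F))})

/-- `β_k(G)`, the supremum over all finite dimensional `G`-modules `V` of `β_k(F[V]^G)`. -/
noncomputable def betaGrp (F : Type*) [Field F] (G : Type*) [Group G] (k : ℕ) : ℕ∞ :=
  ⨆ (n : ℕ) (ρ : Representation F G (Fin n → F)), betaAlg (invRing ρ) k

/-- `S` is a finitely generated module over its subalgebra `T`. -/
noncomputable def fgOver {F : Type*} [Field F] {ι : Type*} (S T : Subalgebra F (MvPolynomial ι F)) : Prop :=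
  ∃ B : Finset (MvPolynomial ι F), (B : Set (MvPolynomial ι F)) ⊆ S ∧
    Subalgebra.toSubmodule S ≤ Subalgebra.toSubmodule T * Submodule.span F (B : Set (MvPolynomial ι F))

/-- `σ(S)`: the minimal `d` such that `S` is a finitely generated module over the subalgebra
`F[S_{≤ d}]` generated by the homogeneous elements of `S` of degree at most `d`. -/
noncomputable def sigmaAlg {F : Type*} [Field F] {ι : Type*}
    (S : Subalgebra F (MvPolynomial ι F)) : ℕ :=
  sInf {d : ℕ | fgOver S (Algebra.adjoin F (⋃ i ∈ Set.Iic d, (subComp S i : Set (MvPolynomial ι F))))}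

/-- `σ(G)`, the supremum over all finite dimensional `G`-modules `V` of `σ(F[V]^G)`. -/
noncomputable def sigmaGrp (F : Type*) [Field F] (G : Type*) [Group G] : ℕ∞ :=
  ⨆ (n : ℕ) (ρ : Representation F G (Fin n → F)), (sigmaAlg (invRing ρ) : ℕ∞)

/-- An irreducible (simple, nonzero) representation. -/
def IsIrredRep {F : Type*} [Field F] {G : Type*} [Group G] {V : Type*}
    [AddCommGroup V] [Module F V] (π : Representation F G V) : Prop :=
  Nontrivial V ∧ ∀ W : Submodule F V, (∀ g : G, ∀ x ∈ W, π g x ∈ W) → W = ⊥ ∨ W = ⊤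


set_option linter.unusedSectionVars false

section helpers

variable {F : Type*} [Field F] {G : Type*} [Group G] {ι : Type*} [Fintype ι] [DecidableEq ι]

theorem polyAct_X (ρ : Representation F G (ι → F)) (g : G) (i : ι) :
    polyAct ρ g (X i) = ∑ j, (ρ g (Pi.single j 1) i) • (X j : MvPolynomial ι F) := by
  simp [polyAct]

theorem rep_expand (ρ : Representation F G (ι → F)) (g : G) (v : ι → F) (i : ι) :
    ρ g v i = ∑ j, v j * ρ g (Pi.single j 1) i := by
  conv_lhs => rw [pi_eq_sum_univ' v]
  simp [Finset.sum_apply, map_sum]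

theorem polyAct_one (ρ : Representation F G (ι → F)) :
    polyAct ρ 1 = AlgHom.id F (MvPolynomial ι F) := by
  apply MvPolynomial.algHom_ext
  intro i
  rw [polyAct_X]
  simp [Pi.single_apply, ite_smul]

theorem polyAct_comp (ρ : Representation F G (ι → F)) (g h : G) :
    (polyAct ρ g).comp (polyAct ρ h) = polyAct ρ (h * g) := by
  apply MvPolynomial.algHom_ext
  intro i
  simp only [AlgHom.comp_apply, polyAct_X, map_sum, map_smul, Finset.smul_sum, smul_smul]
  rw [Finset.sum_comm]
  refine Finset.sum_congr rfl fun l _ => ?_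
  rw [← Finset.sum_smul, map_mul, Module.End.mul_apply, rep_expand ρ h (ρ g _)]
  simp only [mul_comm]

theorem polyAct_polyAct (ρ : Representation F G (ι → F)) (g h : G) (f : MvPolynomial ι F) :
    polyAct ρ g (polyAct ρ h f) = polyAct ρ (h * g) f := by
  rw [← polyAct_comp]; rfl

theorem aeval_hom {σ τ : Type*} (u : σ → MvPolynomial τ F) (hu : ∀ i, (u i).IsHomogeneous 1)
    {f : MvPolynomial σ F} {d : ℕ} (hf : f.IsHomogeneous d) : (aeval u f).IsHomogeneous d := by
  simpa using hf.aeval u hu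

theorem polyAct_hom (ρ : Representation F G (ι → F)) (g : G) {f : MvPolynomial ι F} {d : ℕ}
    (hf : f.IsHomogeneous d) : (polyAct ρ g f).IsHomogeneous d := by
  refine aeval_hom _ (fun i => ?_) hf
  refine IsHomogeneous.sum _ _ _ fun j _ => ?_
  rw [smul_eq_C_mul]
  exact (isHomogeneous_X F j).C_mul _

theorem mem_invRing (ρ : Representation F G (ι → F)) (f : MvPolynomial ι F) :
    f ∈ invRing ρ ↔ ∀ g, polyAct ρ g f = f := by
  simp [invRing, Algebra.mem_iInf, AlgHom.mem_equalizer]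

theorem subComp_le_subPos {σ : Type*} (S : Subalgebra F (MvPolynomial σ F)) {d : ℕ} (hd : 0 < d) :
    subComp S d ≤ subPos S :=
  le_iSup₂_of_le (f := fun d (_ : d ∈ Set.Ioi (0 : ℕ)) => subComp S d) d hd le_rfl

/-- The Reynolds operator. -/
noncomputable def reyn [Fintype G] (ρ : Representation F G (ι → F)) :
    MvPolynomial ι F →ₗ[F] MvPolynomial ι F :=
  ((Nat.card G : F)⁻¹) • ∑ g : G, (polyAct ρ g).toLinearMap

theorem reyn_apply [Fintype G] (ρ : Representation F G (ι → F)) (f : MvPolynomial ι F) :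
    reyn ρ f = ((Nat.card G : F)⁻¹) • ∑ g : G, polyAct ρ g f := by
  simp [reyn]

theorem reyn_mem [Fintype G] (ρ : Representation F G (ι → F)) (f : MvPolynomial ι F) :
    reyn ρ f ∈ invRing ρ := by
  rw [mem_invRing]
  intro g
  rw [reyn_apply, map_smul, map_sum]
  congr 1
  simp only [polyAct_polyAct]
  exact Fintype.sum_equiv (Equiv.mulRight g) _ _ fun _ => rfl

theorem reyn_mul [Fintype G] (ρ : Representation F G (ι → F)) {s : MvPolynomial ι F}
    (hs : s ∈ invRing ρ) (f : MvPolynomial ι F) : reyn ρ (s * f) = s * reyn ρ f := by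
  rw [mem_invRing] at hs
  simp only [reyn_apply, map_mul, hs, ← Finset.mul_sum, mul_smul_comm]

theorem reyn_self [Fintype G] (hG : (Nat.card G : F) ≠ 0) (ρ : Representation F G (ι → F))
    {s : MvPolynomial ι F} (hs : s ∈ invRing ρ) : reyn ρ s = s := by
  rw [mem_invRing] at hs
  simp only [reyn_apply, hs, Finset.sum_const, Finset.card_univ, ← Nat.card_eq_fintype_card]
  rw [← Nat.cast_smul_eq_nsmul F, smul_smul, inv_mul_cancel₀ hG, one_smul]

theorem reyn_comp [Fintype G] (ρ : Representation F G (ι → F)) {f : MvPolynomial ι F} {d : ℕ}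
    (hf : f.IsHomogeneous d) : reyn ρ f ∈ subComp (invRing ρ) d := by
  refine ⟨reyn_mem ρ f, ?_⟩
  rw [reyn_apply]
  exact Submodule.smul_mem _ _ (Submodule.sum_mem _ fun g _ => polyAct_hom ρ g hf)

theorem reyn_pos [Fintype G] (ρ : Representation F G (ι → F)) :
    (homogeneousSubmodule ι F 1 * ⊤).map (reyn ρ) ≤ subPos (invRing ρ) := by
  rw [Submodule.map_le_iff_le_comap, Submodule.mul_le]
  intro x hx q _
  rw [Submodule.mem_comap, ← sum_homogeneousComponent q, Finset.mul_sum, map_sum]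
  refine Submodule.sum_mem _ fun j _ => ?_
  exact subComp_le_subPos _ (by omega : 0 < 1 + j)
    (reyn_comp ρ (IsHomogeneous.mul hx (homogeneousComponent_isHomogeneous j q)))

theorem subPos_le {σ : Type*} (S : Subalgebra F (MvPolynomial σ F)) :
    subPos S ≤ Subalgebra.toSubmodule S :=
  iSup₂_le fun _ _ => inf_le_left

theorem subPos_pow_le {σ : Type*} (S : Subalgebra F (MvPolynomial σ F)) (k : ℕ) :
    subPos S ^ k ≤ Subalgebra.toSubmodule S := by
  induction k with
  | zero =>
    rw [pow_zero, Submodule.one_le]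
    exact S.one_mem
  | succ k ih =>
    rw [pow_succ, Submodule.mul_le]
    exact fun a ha b hb => S.mul_mem (ih ha) (subPos_le S hb)

theorem hom_succ_le {σ : Type*} (d : ℕ) :
    homogeneousSubmodule σ F (d + 1) ≤ homogeneousSubmodule σ F 1 * homogeneousSubmodule σ F d := by
  classical
  intro f hf
  rw [mem_homogeneousSubmodule] at hf
  rw [f.as_sum]
  refine Submodule.sum_mem _ fun m hm => ?_
  have hdeg : m.degree = d + 1 := by
    have := hf (mem_support_iff.mp hm)
    rw [Finsupp.degree_eq_weight_one]
    exact this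
  have hm0 : m ≠ 0 := by
    rintro rfl
    simp at hdeg
  obtain ⟨i, hi⟩ := Finsupp.ne_iff.mp hm0
  have hle : Finsupp.single i 1 ≤ m := by
    rw [Finsupp.single_le_iff]
    exact Nat.one_le_iff_ne_zero.mpr hi
  have hsum : Finsupp.single i 1 + (m - Finsupp.single i 1) = m := add_tsub_cancel_of_le hle
  have hd' : (m - Finsupp.single i 1).degree = d := by
    have := congrArg Finsupp.degree hsum
    rw [map_add, Finsupp.degree_single, hdeg] at this
    omega
  have : monomial m (coeff m f) = X i * monomial (m - Finsupp.single i 1) (coeff m f) := by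
    rw [X, monomial_mul, hsum, one_mul]
  rw [this]
  exact Submodule.mul_mem_mul (isHomogeneous_X F i) (isHomogeneous_monomial _ hd')

theorem upper (hG : (Nat.card G : F) ≠ 0) [Finite G] (ρ : Representation F G (ι → F)) (k d : ℕ)
    (h : homogeneousSubmodule ι F d ≤ subPos (invRing ρ) ^ k * ⊤) :
    subComp (invRing ρ) (d + 1) ≤ subPos (invRing ρ) ^ (k + 1) := by
  have := Fintype.ofFinite G
  rintro f ⟨hf, hfd⟩
  have h1 : f ∈ subPos (invRing ρ) ^ k * (homogeneousSubmodule ι F 1 * ⊤) := by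
    have := mul_le_mul' (le_refl (homogeneousSubmodule ι F 1)) h (hom_succ_le d hfd)
    rwa [mul_left_comm] at this
  rw [← reyn_self hG ρ hf, pow_succ]
  have h2 : subPos (invRing ρ) ^ k * (homogeneousSubmodule ι F 1 * ⊤) ≤
      (subPos (invRing ρ) ^ k * subPos (invRing ρ)).comap (reyn ρ) := by
    rw [Submodule.mul_le]
    intro s hs q hq
    rw [Submodule.mem_comap, reyn_mul ρ (subPos_pow_le _ _ hs)]
    exact Submodule.mul_mem_mul hs (reyn_pos ρ (Submodule.mem_map_of_mem hq))
  exact h2 h1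

variable {κ : Type*} [Fintype κ] [DecidableEq κ]

/-- The representation `V ⊕ F[G]` on coordinates `κ ≃ ι ⊕ G`. -/
def extRep (ρ : Representation F G (ι → F)) (e : ι ⊕ G ≃ κ) : Representation F G (κ → F) where
  toFun g :=
    { toFun := fun w c => Sum.elim (fun i => ρ g (fun i' => w (e (Sum.inl i'))) i)
        (fun h => w (e (Sum.inr (h * g)))) (e.symm c)
      map_add' := by
        intro v w
        funext c
        obtain ⟨c, rfl⟩ := e.surjective c
        rcases c with i | h
        · simp only [Equiv.symm_apply_apply, Sum.elim_inl, Pi.add_apply]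
          exact congrFun (map_add (ρ g) (fun i' => v (e (Sum.inl i'))) (fun i' => w (e (Sum.inl i')))) i
        · simp
      map_smul' := by
        intro a w
        funext c
        obtain ⟨c, rfl⟩ := e.surjective c
        rcases c with i | h
        · simp only [Equiv.symm_apply_apply, Sum.elim_inl, Pi.smul_apply, RingHom.id_apply]
          exact congrFun (map_smul (ρ g) a (fun i' => w (e (Sum.inl i')))) i
        · simp }
  map_one' := by
    ext w c
    obtain ⟨c, rfl⟩ := e.surjective c
    rcases c with i | h <;> simp
  map_mul' g g' := by
    refine LinearMap.ext fun w => funext fun c => ?_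
    obtain ⟨c, rfl⟩ := e.surjective c
    rcases c with i | h
    · simp
    · simp [mul_assoc]

theorem extRep_inl (ρ : Representation F G (ι → F)) (e : ι ⊕ G ≃ κ) (g : G) (w : κ → F) (i : ι) :
    extRep ρ e g w (e (Sum.inl i)) = ρ g (fun i' => w (e (Sum.inl i'))) i := by
  simp [extRep]

theorem extRep_inr (ρ : Representation F G (ι → F)) (e : ι ⊕ G ≃ κ) (g : G) (w : κ → F) (h : G) :
    extRep ρ e g w (e (Sum.inr h)) = w (e (Sum.inr (h * g))) := by
  simp [extRep]

/-- Inclusion of coordinate rings. -/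
noncomputable def incl (F : Type*) [Field F] (e : ι ⊕ G ≃ κ) :
    MvPolynomial ι F →ₐ[F] MvPolynomial κ F :=
  aeval fun i => X (e (Sum.inl i))

/-- Restriction to `V`. -/
noncomputable def restr (F : Type*) [Field F] (e : ι ⊕ G ≃ κ) :
    MvPolynomial κ F →ₐ[F] MvPolynomial ι F :=
  aeval fun c => Sum.elim (fun i => X i) (fun _ => 0) (e.symm c)

theorem restr_hom (e : ι ⊕ G ≃ κ) {f : MvPolynomial κ F} {d : ℕ} (hf : f.IsHomogeneous d) :
    (restr F e f).IsHomogeneous d := by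
  refine aeval_hom _ (fun c => ?_) hf
  rcases e.symm c with i | h
  · exact isHomogeneous_X F i
  · exact isHomogeneous_zero _ _ _

theorem restr_inl (e : ι ⊕ G ≃ κ) (i : ι) : restr F e (X (e (Sum.inl i))) = X i := by
  simp [restr]

theorem restr_inr (e : ι ⊕ G ≃ κ) (h : G) : restr F e (X (e (Sum.inr h))) = 0 := by
  simp [restr]

theorem restr_incl (e : ι ⊕ G ≃ κ) (f : MvPolynomial ι F) : restr F e (incl F e f) = f := by
  have : (restr F e).comp (incl F e) = AlgHom.id F _ := by
    apply MvPolynomial.algHom_ext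
    intro i
    simp [incl, restr]
  exact DFunLike.congr_fun this f

theorem act_inr (ρ : Representation F G (ι → F)) (e : ι ⊕ G ≃ κ) (g h : G) :
    polyAct (extRep ρ e) g (X (e (Sum.inr h))) = X (e (Sum.inr (h * g))) := by
  rw [polyAct_X]
  simp only [extRep_inr]
  simp [Pi.single_apply, ite_smul]

theorem act_inl [Fintype G] (ρ : Representation F G (ι → F)) (e : ι ⊕ G ≃ κ) (g : G) (i : ι) :
    polyAct (extRep ρ e) g (X (e (Sum.inl i))) = incl F e (polyAct ρ g (X i)) := by
  rw [polyAct_X, polyAct_X, ← e.sum_comp, Fintype.sum_sum_type, map_sum]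
  simp only [extRep_inl]
  have h1 : ∀ j : ι, (fun i' => (Pi.single (e (Sum.inl j)) 1 : κ → F) (e (Sum.inl i'))) =
      Pi.single j 1 := by
    intro j; funext i'
    simp [Pi.single_apply]
  have h2 : ∀ j : G, (fun i' => (Pi.single (e (Sum.inr j)) 1 : κ → F) (e (Sum.inl i'))) = 0 := by
    intro j; funext i'
    simp [Pi.single_apply]
  simp only [h1, h2]
  simp [incl]

theorem act_incl [Fintype G] (ρ : Representation F G (ι → F)) (e : ι ⊕ G ≃ κ) (g : G)
    (f : MvPolynomial ι F) :
    polyAct (extRep ρ e) g (incl F e f) = incl F e (polyAct ρ g f) := by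
  have : (polyAct (extRep ρ e) g).comp (incl F e) = (incl F e).comp (polyAct ρ g) := by
    apply MvPolynomial.algHom_ext
    intro i
    rw [AlgHom.comp_apply, AlgHom.comp_apply, ← act_inl]
    simp [incl]
  exact DFunLike.congr_fun this f

theorem restr_act [Fintype G] (ρ : Representation F G (ι → F)) (e : ι ⊕ G ≃ κ) (g : G)
    (f : MvPolynomial κ F) :
    restr F e (polyAct (extRep ρ e) g f) = polyAct ρ g (restr F e f) := by
  have : (restr F e).comp (polyAct (extRep ρ e) g) = (polyAct ρ g).comp (restr F e) := by
    apply MvPolynomial.algHom_ext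
    intro c
    obtain ⟨c, rfl⟩ := e.surjective c
    rcases c with i | h
    · rw [AlgHom.comp_apply, AlgHom.comp_apply, act_inl, restr_incl, restr_inl]
    · rw [AlgHom.comp_apply, AlgHom.comp_apply, act_inr, restr_inr, restr_inr, map_zero]
  exact DFunLike.congr_fun this f

theorem restr_pos [Fintype G] (ρ : Representation F G (ι → F)) (e : ι ⊕ G ≃ κ) :
    subPos (invRing (extRep ρ e)) ≤ (subPos (invRing ρ)).comap (restr F e).toLinearMap := by
  refine iSup₂_le fun d hd => ?_
  rintro f ⟨hf, hfd⟩
  refine subComp_le_subPos _ hd ⟨?_, restr_hom e hfd⟩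
  refine (mem_invRing _ _).mpr fun g => ?_
  have := (mem_invRing _ _).mp hf g
  change polyAct ρ g (restr F e f) = restr F e f
  rw [← restr_act, this]

theorem restr_pow [Fintype G] (ρ : Representation F G (ι → F)) (e : ι ⊕ G ≃ κ) (k : ℕ)
    {f : MvPolynomial κ F} (hf : f ∈ subPos (invRing (extRep ρ e)) ^ (k + 1)) :
    restr F e f ∈ subPos (invRing ρ) ^ (k + 1) ∧
      restr F e (pderiv (e (Sum.inr 1)) f) ∈ subPos (invRing ρ) ^ k * ⊤ := by
  induction k generalizing f with
  | zero =>
    rw [zero_add, pow_one] at hf ⊢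
    refine ⟨restr_pos ρ e hf, ?_⟩
    rw [pow_zero, one_mul]
    trivial
  | succ k ih =>
    rw [pow_succ] at hf
    induction hf using Submodule.mul_induction_on' with
    | mem_mul_mem a ha b hb =>
      obtain ⟨h1, h2⟩ := ih ha
      have h3 : restr F e b ∈ subPos (invRing ρ) := restr_pos ρ e hb
      constructor
      · rw [map_mul, pow_succ _ (k + 1)]
        exact Submodule.mul_mem_mul h1 h3
      · rw [Derivation.leibniz, map_add, smul_eq_mul, smul_eq_mul, map_mul, map_mul]
        refine Submodule.add_mem _ (Submodule.mul_mem_mul h1 trivial) ?_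
        rw [pow_succ', mul_assoc]
        exact Submodule.mul_mem_mul h3 h2
    | add a _ b _ iha ihb =>
      rw [map_add, map_add, map_add]
      exact ⟨Submodule.add_mem _ iha.1 ihb.1, Submodule.add_mem _ iha.2 ihb.2⟩

theorem lower [Finite G] (ρ : Representation F G (ι → F)) (e : ι ⊕ G ≃ κ) (k d : ℕ)
    (h : subComp (invRing (extRep ρ e)) (d + 1) ≤ subPos (invRing (extRep ρ e)) ^ (k + 1)) :
    homogeneousSubmodule ι F d ≤ subPos (invRing ρ) ^ k * ⊤ := by
  classical
  have := Fintype.ofFinite G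
  intro f hf
  set t : MvPolynomial κ F := ∑ h : G, X (e (Sum.inr h)) * incl F e (polyAct ρ h f) with ht
  have htm : t ∈ subComp (invRing (extRep ρ e)) (d + 1) := by
    constructor
    · refine (mem_invRing _ _).mpr fun g => ?_
      rw [ht, map_sum]
      simp only [map_mul, act_inr, act_incl, polyAct_polyAct]
      exact Fintype.sum_equiv (Equiv.mulRight g) _ _ fun _ => rfl
    · refine Submodule.sum_mem _ fun g _ => ?_
      rw [mem_homogeneousSubmodule, add_comm]
      exact (isHomogeneous_X F _).mul
        (aeval_hom _ (fun i => isHomogeneous_X F _) (polyAct_hom ρ g hf))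
  have h1 := (restr_pow ρ e k (h htm)).2
  have h2 : restr F e (pderiv (e (Sum.inr 1)) t) = f := by
    rw [ht, map_sum, map_sum]
    simp only [Derivation.leibniz, map_add, smul_eq_mul, map_mul, restr_inr, restr_incl, zero_mul,
      zero_add, pderiv_X]
    rw [Finset.sum_eq_single (1 : G)]
    · simp [polyAct_one]
    · intro b _ hb
      simp [Pi.single_apply, hb, Ne.symm hb]
    · simp
  rwa [h2] at h1

theorem zero_not (S : Subalgebra F (MvPolynomial ι F)) (k : ℕ) (hk : 1 ≤ k) :
    ¬ homogeneousSubmodule ι F 0 ≤ subPos S ^ k * (⊤ : Submodule F (MvPolynomial ι F)) := by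
  intro h
  have h0 : ∀ s ∈ subPos S, constantCoeff s = 0 := by
    have : subPos S ≤ LinearMap.ker (lcoeff F (0 : ι →₀ ℕ)) := by
      refine iSup₂_le fun d hd => ?_
      rintro f ⟨_, hfd⟩
      rw [LinearMap.mem_ker, lcoeff_apply]
      exact IsHomogeneous.coeff_eq_zero hfd (by simpa using (ne_of_gt hd).symm)
    exact fun s hs => this hs
  obtain ⟨m, rfl⟩ : ∃ m, k = m + 1 := ⟨k - 1, by omega⟩
  have h1 := h (isHomogeneous_one ι F)
  rw [pow_succ', mul_assoc] at h1
  have : subPos S * (subPos S ^ m * ⊤) ≤ LinearMap.ker (lcoeff F (0 : ι →₀ ℕ)) := by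
    rw [Submodule.mul_le]
    intro a ha b _
    change constantCoeff (a * b) = 0
    rw [map_mul, h0 a ha, zero_mul]
  have h2 : constantCoeff (1 : MvPolynomial ι F) = 0 := this h1
  simp at h2

end helpers

/-- If `V` is a `G`-module with `β_k(G,V) = β_k(G)`, then
`β_k(G,V) = β_k(F[V], F[V]^G) + 1`. -/
theorem betaAlg_eq_betaMod_add_one_of_max {F : Type*} [Field F] {G : Type*} [Group G] [Finite G]
    (hG : (Nat.card G : F) ≠ 0) (n : ℕ) (ρ : Representation F G (Fin n → F))
    (k : ℕ) (hk : 1 ≤ k) (hmax : betaAlg (invRing ρ) k = betaGrp F G k) :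
    betaAlg (invRing ρ) k = betaMod (invRing ρ) k + 1 := by
  apply le_antisymm
  · refine sSup_le ?_
    rintro _ ⟨d, ⟨hd, hd'⟩, rfl⟩
    obtain ⟨m, rfl⟩ : ∃ m, d = m + 1 := ⟨d - 1, by omega⟩
    have : (m : ℕ∞) ≤ betaMod (invRing ρ) k :=
      le_sSup ⟨m, fun h => hd' (upper hG ρ k m h), rfl⟩
    push_cast
    gcongr
  · have key : ∀ d : ℕ, ¬ homogeneousSubmodule (Fin n) F d ≤ subPos (invRing ρ) ^ k * ⊤ →
        (d : ℕ∞) + 1 ≤ betaAlg (invRing ρ) k := by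
      intro d hd
      have := Fintype.ofFinite G
      let e : Fin n ⊕ G ≃ Fin (Fintype.card (Fin n ⊕ G)) := Fintype.equivFin _
      rw [hmax]
      refine le_trans ?_ (le_iSup₂_of_le (f := fun (n : ℕ) (ρ : Representation F G (Fin n → F)) =>
        betaAlg (invRing ρ) k) _ (extRep ρ e) le_rfl)
      exact le_sSup ⟨d + 1, ⟨Nat.succ_pos _, fun h => hd (lower ρ e k d h)⟩, by push_cast; rfl⟩
    have h1 : (1 : ℕ∞) ≤ betaAlg (invRing ρ) k := by
      simpa using key 0 (zero_not _ k hk)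
    have h2 : betaMod (invRing ρ) k ≤ betaAlg (invRing ρ) k - 1 := by
      refine sSup_le ?_
      rintro _ ⟨d, hd, rfl⟩
      exact ENat.le_sub_of_add_le_right (by simp) (key d hd)
    calc betaMod (invRing ρ) k + 1 ≤ betaAlg (invRing ρ) k - 1 + 1 := by gcongr
      _ = betaAlg (invRing ρ) k := tsub_add_cancel_of_le h1
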